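/- With Σ_{k,ℓ} as in the recursive definition (parameters 0 < u < 1, σ > u - 1/2): there exists D₀ > 0 depending only on σ and u such that Σ_{k,k} ≥ D₀ (k+1)^{-u} for all natural k (where Σ_{k,k} is defined for any k, even or odd). -/

import Mathlib

/-- Even–even part: `SigEE u σ m n` is `Σ_{2m,2n}` of the recursive definition. -/
noncomputable def SigEE (u σ : ℝ) : ℕ → ℕ → ℝ
  | m, 0 => ∏ i ∈ Finset.Icc 1 m, (1 - (1 - u) / (i : ℝ))
  | m, n + 1 =>
      (SigEE u σ (m - 1) n
        - u * ∑ j ∈ (Finset.range (n + 1)).attach,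
            ((n.factorial : ℝ) * Real.Gamma ((j : ℕ) + 1/2 + σ) /
              ((j : ℕ).factorial * Real.Gamma ((n : ℝ) + 3/2 + σ))) * SigEE u σ (m - 1) (j : ℕ))
      + u * ∑ j ∈ (Finset.range (n + 1)).attach,
            ((n.factorial : ℝ) * Real.Gamma ((j : ℕ) + 1/2 + σ) /
              ((j : ℕ).factorial * Real.Gamma (((n : ℝ) + 1) + 1/2 + σ))) * SigEE u σ m (j : ℕ)
  termination_by m n => n
  decreasing_by
  · omega
  · exact Finset.mem_range.mp j.2
  · exact Finset.mem_range.mp j.2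

/-- Odd–odd part: `SigOO u σ m n` is `Σ_{2m+1,2n+1}` of the recursive definition. -/
noncomputable def SigOO (u σ : ℝ) (m n : ℕ) : ℝ :=
  SigEE u σ m n - u * ∑ j ∈ Finset.range (n + 1),
    ((n.factorial : ℝ) * Real.Gamma ((j : ℝ) + 1/2 + σ) /
      ((j.factorial : ℝ) * Real.Gamma ((n : ℝ) + 3/2 + σ))) * SigEE u σ m j

/-- Coefficients of `(1-x)^(-a)`. -/
noncomputable def cc (a : ℝ) : ℕ → ℝ
  | 0 => 1
  | n + 1 => cc a n * (a + n) / (n + 1)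

lemma cc_succ (a : ℝ) (n : ℕ) : ((n : ℝ) + 1) * cc a (n + 1) = (n + a) * cc a n := by
  have : (n : ℝ) + 1 ≠ 0 := by positivity
  rw [cc]; field_simp; ring

lemma cc_pos {a : ℝ} (ha : 0 < a) (n : ℕ) : 0 < cc a n := by
  induction n with
  | zero => simp [cc]
  | succ n ih => rw [cc]; positivity

lemma cc_gamma {a : ℝ} (ha : 0 < a) (n : ℕ) :
    Real.Gamma ((n : ℝ) + a) = cc a n * n.factorial * Real.Gamma a := by
  induction n with
  | zero => simp [cc]
  | succ n ih =>
    have h1 : (((n + 1 : ℕ) : ℝ) + a) = ((n : ℝ) + a) + 1 := by push_cast; ring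
    have h2 : (n : ℝ) + a ≠ 0 := by positivity
    rw [h1, Real.Gamma_add_one h2, ih, cc, Nat.factorial_succ]
    push_cast
    have : (n : ℝ) + 1 ≠ 0 := by positivity
    field_simp; ring

/-- Coefficients of the generating function. -/
noncomputable def GG (u s : ℝ) (m n : ℕ) : ℝ :=
  ∑ k ∈ Finset.range (n + 1), cc u (m - k) * cc u (n - k) * cc (s - u) k

noncomputable def JJ (u s : ℝ) (m n : ℕ) : ℝ :=
  ∑ k ∈ Finset.range (n + 1), cc u (m - k) * cc u (n - k) * ((s - u + k) * cc (s - u) k)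

lemma sum_GG (u s : ℝ) (m n : ℕ) :
    u * ∑ j ∈ Finset.range n, GG u s m j =
      ∑ k ∈ Finset.range (n + 1),
        cc u (m - k) * (((n : ℝ) - k) * cc u (n - k)) * cc (s - u) k := by
  induction n with
  | zero => simp
  | succ n ih =>
    rw [Finset.sum_range_succ, mul_add, ih, Finset.sum_range_succ _ (n + 1), GG,
      Finset.mul_sum, ← Finset.sum_add_distrib]
    simp only [sub_self, zero_mul, mul_zero, add_zero]
    apply Finset.sum_congr rfl
    intro k hk
    obtain ⟨l, rfl⟩ := Nat.exists_eq_add_of_le (Nat.lt_succ_iff.mp (Finset.mem_range.mp hk))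
    have h1 : k + l + 1 - k = l + 1 := by omega
    have h2 : k + l - k = l := by omega
    have h := cc_succ u l
    rw [h1, h2]
    push_cast
    linear_combination (-cc u (m - k) * cc (s - u) k) * h

lemma GG_odd (u s : ℝ) (m n : ℕ) :
    ((n : ℝ) + s) * GG u s m n - u * ∑ j ∈ Finset.range (n + 1), GG u s m j = JJ u s m n := by
  rw [Finset.sum_range_succ, mul_add, sum_GG, JJ, GG, Finset.mul_sum, Finset.mul_sum,
    ← Finset.sum_add_distrib, ← Finset.sum_sub_distrib]
  apply Finset.sum_congr rfl
  intro k _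
  ring

lemma GG_even (u s : ℝ) (m n : ℕ) :
    ((n : ℝ) + 1) * GG u s m (n + 1) - u * ∑ j ∈ Finset.range (n + 1), GG u s m j
      = JJ u s (m - 1) n := by
  rw [sum_GG, JJ, GG, Finset.mul_sum, ← Finset.sum_sub_distrib, Finset.sum_range_succ']
  simp only [Nat.cast_add, Nat.cast_one, Nat.cast_zero, sub_zero]
  have : ∀ a b c : ℝ, ((n : ℝ) + 1) * (a * b * c) - a * (((n : ℝ) + 1) * b) * c = 0 := by
    intros; ring
  rw [this, add_zero]
  apply Finset.sum_congr rfl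
  intro k _
  have h := cc_succ (s - u) k
  have h1 : n + 1 - (k + 1) = n - k := by omega
  have h2 : m - (k + 1) = m - 1 - k := by omega
  rw [h1, h2]
  linear_combination (cc u (m - 1 - k) * cc u (n - k)) * h

lemma coef_eq {s : ℝ} (hs : 0 < s) (n j : ℕ) :
    ((n.factorial : ℝ) * Real.Gamma ((j : ℝ) + s) /
      ((j.factorial : ℝ) * Real.Gamma ((n : ℝ) + s + 1))) = cc s j / (cc s n * (n + s)) := by
  have h2 : (n : ℝ) + s ≠ 0 := by positivity
  have h3 := (cc_pos hs n).ne'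
  have h4 := (Real.Gamma_pos_of_pos hs).ne'
  rw [Real.Gamma_add_one h2, cc_gamma hs, cc_gamma hs]
  field_simp

lemma prod_eq (u : ℝ) (m : ℕ) : ∏ i ∈ Finset.Icc 1 m, (1 - (1 - u) / (i : ℝ)) = cc u m := by
  induction m with
  | zero => simp [cc]
  | succ m ih =>
    rw [Finset.prod_Icc_succ_top (by omega), ih, cc]
    have : (m : ℝ) + 1 ≠ 0 := by positivity
    push_cast
    field_simp; ring

lemma SigOO_eq' (u σ : ℝ) (hs : 0 < σ + 1/2) (m n : ℕ)
    (h : ∀ j ≤ n, cc (σ + 1/2) j * SigEE u σ m j = GG u (σ + 1/2) m j) :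
    ((n : ℝ) + (σ + 1/2)) * cc (σ + 1/2) n * SigOO u σ m n = JJ u (σ + 1/2) m n := by
  have h2 : (n : ℝ) + (σ + 1/2) ≠ 0 := by positivity
  have h3 := (cc_pos hs n).ne'
  have hsum : ∑ j ∈ Finset.range (n + 1),
    ((n.factorial : ℝ) * Real.Gamma ((j : ℝ) + 1/2 + σ) /
      ((j.factorial : ℝ) * Real.Gamma ((n : ℝ) + 3/2 + σ))) * SigEE u σ m j =
      (∑ j ∈ Finset.range (n + 1), GG u (σ + 1/2) m j) / (cc (σ + 1/2) n * (n + (σ + 1/2))) := by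
    rw [Finset.sum_div]
    apply Finset.sum_congr rfl
    intro j hj
    rw [← h j (Nat.lt_succ_iff.mp (Finset.mem_range.mp hj))]
    have e1 : (j : ℝ) + 1/2 + σ = j + (σ + 1/2) := by ring
    have e2 : (n : ℝ) + 3/2 + σ = n + (σ + 1/2) + 1 := by ring
    rw [e1, e2, coef_eq hs]
    ring
  rw [SigOO, hsum, ← GG_odd, ← h n le_rfl]
  clear hsum h
  generalize σ + 1/2 = s at *
  generalize ∑ j ∈ Finset.range (n + 1), GG u s m j = T
  field_simp

lemma SigEE_succ (u σ : ℝ) (m n : ℕ) :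
    SigEE u σ m (n + 1) = SigOO u σ (m - 1) n + (SigEE u σ m n - SigOO u σ m n) := by
  rw [SigEE, SigOO, SigOO]
  have e : (n : ℝ) + 1 + 1/2 + σ = n + 3/2 + σ := by ring
  rw [e, Finset.sum_attach (Finset.range (n + 1)) (fun j => ((n.factorial : ℝ) * Real.Gamma ((j : ℝ) + 1/2 + σ) /
      ((j.factorial : ℝ) * Real.Gamma ((n : ℝ) + 3/2 + σ))) * SigEE u σ m j),
    Finset.sum_attach (Finset.range (n + 1)) (fun j => ((n.factorial : ℝ) * Real.Gamma ((j : ℝ) + 1/2 + σ) /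
      ((j.factorial : ℝ) * Real.Gamma ((n : ℝ) + 3/2 + σ))) * SigEE u σ (m - 1) j)]
  ring

lemma SigEE_eq (u σ : ℝ) (hs : 0 < σ + 1/2) (n : ℕ) :
    ∀ m, cc (σ + 1/2) n * SigEE u σ m n = GG u (σ + 1/2) m n := by
  induction n using Nat.strong_induction_on with
  | _ n ih =>
    intro m
    cases n with
    | zero => rw [SigEE, prod_eq]; simp [GG, cc]
    | succ n =>
      have h1 := SigOO_eq' u σ hs (m - 1) n (fun j hj => ih j (by omega) (m - 1))
      have h2 := SigOO_eq' u σ hs m n (fun j hj => ih j (by omega) m)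
      have h3 := ih n (by omega) m
      have h4 := GG_odd u (σ + 1/2) m n
      have h5 := GG_even u (σ + 1/2) m n
      have h6 := cc_succ (σ + 1/2) n
      have h7 : (n : ℝ) + 1 ≠ 0 := by positivity
      rw [SigEE_succ]
      apply mul_left_cancel₀ h7
      rw [← mul_assoc, h6]
      linear_combination h1 - h2 + (n + (σ + 1/2)) * h3 + h4 - h5

lemma ratio_bound {u s : ℝ} (hu0 : 0 < u) (hu1 : u < 1) (hs : u < s) (m : ℕ) :
    Real.Gamma s / Real.Gamma (s - u) * ((m : ℝ) + (s - u)) ^ (-u) * cc s m ≤ cc (s - u) m := by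
  have hd : 0 < s - u := by linarith
  have hs0 : 0 < s := by linarith
  have hx : 0 < (m : ℝ) + (s - u) := by positivity
  have h := Real.Gamma_mul_add_mul_le_rpow_Gamma_mul_rpow_Gamma hx
    (show 0 < (m : ℝ) + (s - u) + 1 by linarith) (show 0 < 1 - u by linarith) hu0 (by ring)
  have e : (1 - u) * ((m : ℝ) + (s - u)) + u * ((m : ℝ) + (s - u) + 1) = m + s := by ring
  have hG := Real.Gamma_pos_of_pos hx
  rw [e, Real.Gamma_add_one hx.ne', Real.mul_rpow hx.le hG.le, mul_left_comm,
    ← Real.rpow_add hG, sub_add_cancel, Real.rpow_one, cc_gamma hs0, cc_gamma hd] at h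
  have g1 := Real.Gamma_pos_of_pos hd
  have hf : (0 : ℝ) < m.factorial := by positivity
  rw [Real.rpow_neg hx.le]
  have hp : 0 < ((m : ℝ) + (s - u)) ^ u := Real.rpow_pos_of_pos hx u
  rw [← div_eq_mul_inv, div_div, div_mul_eq_mul_div, div_le_iff₀ (by positivity)]
  apply le_of_mul_le_mul_right _ hf
  nlinarith [h]

theorem sigma_diagonal_lower_bound (u σ : ℝ) (hu0 : 0 < u) (hu1 : u < 1)
    (hσ : u - 1/2 < σ) :
    ∃ D₀ > (0 : ℝ), ∀ m : ℕ,
      D₀ * ((2 * (m : ℝ)) + 1) ^ (-u) ≤ SigEE u σ m m ∧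
      D₀ * ((2 * (m : ℝ) + 1) + 1) ^ (-u) ≤ SigOO u σ m m := by
  have hs0 : 0 < σ + 1/2 := by linarith
  have hus : u < σ + 1/2 := by linarith
  have hE := SigEE_eq u σ hs0
  have hO := fun m n => SigOO_eq' u σ hs0 m n (fun j _ => hE j m)
  generalize σ + 1/2 = s at *
  have hd : 0 < s - u := by linarith
  have g1 := Real.Gamma_pos_of_pos hd
  have g2 := Real.Gamma_pos_of_pos hs0
  set K := 1 + (s - u) with hK
  have hK0 : 0 < K := by linarith
  set C := Real.Gamma s / Real.Gamma (s - u) * K ^ (-u) with hC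
  have hC0 : 0 < C := mul_pos (div_pos g2 g1) (Real.rpow_pos_of_pos hK0 _)
  have key : ∀ m : ℕ, C * (2 * (m : ℝ) + 1) ^ (-u) * cc s m ≤ cc (s - u) m := by
    intro m
    refine le_trans ?_ (ratio_bound hu0 hu1 hus m)
    have hx : 0 < (m : ℝ) + (s - u) := by positivity
    rw [hC, mul_assoc (Real.Gamma s / _), ← Real.mul_rpow hK0.le (by positivity)]
    have hb : (K * (2 * (m : ℝ) + 1)) ^ (-u) ≤ ((m : ℝ) + (s - u)) ^ (-u) := by
      apply Real.rpow_le_rpow_of_nonpos hx _ (by linarith)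
      have hm : (0 : ℝ) ≤ m := by positivity
      nlinarith [mul_nonneg hm hd.le]
    have := cc_pos hs0 m
    gcongr
  have hr : (s - u) / s ≤ 1 := by rw [div_le_one hs0]; linarith
  have hr0 : 0 < (s - u) / s := by positivity
  refine ⟨(s - u) / s * C, by positivity, fun m => ?_⟩
  have hc := cc_pos hs0 m
  have hq := cc_pos hd m
  have hp : 0 < (2 * (m : ℝ) + 1) ^ (-u) := Real.rpow_pos_of_pos (by positivity) _
  have hGm : cc (s - u) m ≤ GG u s m m := by
    have := Finset.single_le_sum (s := Finset.range (m + 1))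
      (f := fun k => cc u (m - k) * cc u (m - k) * cc (s - u) k)
      (fun k _ => (mul_pos (mul_pos (cc_pos hu0 _) (cc_pos hu0 _)) (cc_pos hd k)).le)
      (Finset.self_mem_range_succ m)
    simpa [cc, GG] using this
  have hJm : (s - u + m) * cc (s - u) m ≤ JJ u s m m := by
    have := Finset.single_le_sum (s := Finset.range (m + 1))
      (f := fun k => cc u (m - k) * cc u (m - k) * ((s - u + k) * cc (s - u) k))
      (fun k _ => (mul_pos (mul_pos (cc_pos hu0 _) (cc_pos hu0 _))
        (mul_pos (by positivity) (cc_pos hd k))).le)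
      (Finset.self_mem_range_succ m)
    simpa [cc, JJ] using this
  constructor
  · apply le_of_mul_le_mul_left _ hc
    rw [hE]
    calc _ = (s - u) / s * (C * (2 * (m : ℝ) + 1) ^ (-u) * cc s m) := by ring
      _ ≤ 1 * (C * (2 * (m : ℝ) + 1) ^ (-u) * cc s m) := by gcongr
      _ ≤ _ := by rw [one_mul]; exact (key m).trans hGm
  · have hms : 0 < (m : ℝ) + s := by positivity
    apply le_of_mul_le_mul_left _ (mul_pos hms hc)
    rw [hO]
    have hmono : (2 * (m : ℝ) + 1 + 1) ^ (-u) ≤ (2 * (m : ℝ) + 1) ^ (-u) :=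
      Real.rpow_le_rpow_of_nonpos (by positivity) (by linarith) (by linarith)
    have hfac : ((m : ℝ) + s) * ((s - u) / s) ≤ s - u + m := by
      have : ((m : ℝ) + s) * ((s - u) / s) = m * ((s - u) / s) + (s - u) := by field_simp
      have hm : (0 : ℝ) ≤ m := by positivity
      nlinarith
    calc _ = ((m : ℝ) + s) * ((s - u) / s) * (C * (2 * (m : ℝ) + 1 + 1) ^ (-u) * cc s m) := by ring
      _ ≤ ((m : ℝ) + s) * ((s - u) / s) * (C * (2 * (m : ℝ) + 1) ^ (-u) * cc s m) := by gcongr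
      _ ≤ (s - u + m) * (C * (2 * (m : ℝ) + 1) ^ (-u) * cc s m) := by gcongr
      _ ≤ (s - u + m) * cc (s - u) m := by
        have := key m
        gcongr
      _ ≤ _ := hJm
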